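/- arXiv:2309.17263 — 2 statements merged into one kernel-verified Lean document; each statement's English description precedes it below -/
import Mathlib

section
/- Let w₈ be the 8×8 integer matrix defined by: w₈(x,y) = 0 unless x is odd and y is even, and for x ∈ {1,3,5,7}, y ∈ {0,2,4,6}, w₈(x,y) = d_{((y−x+1)/2) mod 4} with (d₀,d₁,d₂,d₃) = (1,7,−11,−5) (so row 1 has entries 1,7,−11,−5 at columns 0,2,4,6; row 3 has −5,1,7,−11; row 5 has −11,−5,1,7; row 7 has 7,−11,−5,1). Then: (i) for all deterministic strategies E1,E2 : {0,…,7} → {0,1} and D : {0,1}×{0,1} → {0,1}, the payoff Σ_{(x,y) : D(E1(x),E2(y))=0} w₈(x,y) ≤ 8; (ii) Σ_{x,y} w₈(x,y)·(1/4)(1 + cos(2π(x−y)/8)) = 12√2 − 8; and (iii) 12√2 − 8 > 8. -/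
noncomputable section

/-- The witness matrix `w₈` for the octagon MAC: zero unless the row index is
odd and the column index is even, with nonzero entries cycling through
`(1, 7, −11, −5)`. -/
def w8 : Matrix (Fin 8) (Fin 8) ℤ :=
  !![0, 0, 0, 0, 0, 0, 0, 0;
     1, 0, 7, 0, -11, 0, -5, 0;
     0, 0, 0, 0, 0, 0, 0, 0;
     -5, 0, 1, 0, 7, 0, -11, 0;
     0, 0, 0, 0, 0, 0, 0, 0;
     -11, 0, -5, 0, 1, 0, 7, 0;
     0, 0, 0, 0, 0, 0, 0, 0;
     7, 0, -11, 0, -5, 0, 1, 0]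

/-- Bound on the payoff of a strategy: `a`, `b` are the encoder bits on the odd rows and even columns,
`r₀₀`, …, `r₁₁` are the outputs of the decoder, and `r i j z` is the payoff from an entry `z` of the
witness on which the messages are `i` and `j`. -/
lemma payoff_le (r₀₀ r₀₁ r₁₀ r₁₁ a₁ a₃ a₅ a₇ b₀ b₂ b₄ b₆ : Bool) :
    let r : Bool → Bool → ℤ → ℤ := fun i j z =>
      cond (cond i (cond j r₁₁ r₁₀) (cond j r₀₁ r₀₀)) 0 z
    r a₁ b₀ 1 + r a₁ b₂ 7 + r a₁ b₄ (-11) + r a₁ b₆ (-5) +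
      (r a₃ b₀ (-5) + r a₃ b₂ 1 + r a₃ b₄ 7 + r a₃ b₆ (-11)) +
      (r a₅ b₀ (-11) + r a₅ b₂ (-5) + r a₅ b₄ 1 + r a₅ b₆ 7) +
      (r a₇ b₀ 7 + r a₇ b₂ (-11) + r a₇ b₄ (-5) + r a₇ b₆ 1) ≤ 8 := by
  revert r₀₀ r₀₁ r₁₀ r₁₁ a₁ a₃ a₅ a₇ b₀ b₂ b₄ b₆
  decide +kernel

lemma classical_payoff_le (E1 E2 : Fin 8 → Bool) (D : Bool × Bool → Bool) :
    (∑ p ∈ Finset.univ.filter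
      (fun p : Fin 8 × Fin 8 => D (E1 p.1, E2 p.2) = false), w8 p.1 p.2) ≤ 8 := by
  have hD (i j : Bool) (z : ℤ) : (if D (i, j) = false then z else 0) =
      cond (cond i (cond j (D (true, true)) (D (true, false)))
        (cond j (D (false, true)) (D (false, false)))) 0 z := by
    cases i <;> cases j <;> simp only [cond_true, cond_false] <;> split_ifs with h <;> simp [h]
  rw [Finset.sum_filter, Fintype.sum_prod_type]
  simp only [hD]
  have h := payoff_le (D (false, false)) (D (false, true)) (D (true, false)) (D (true, true))
    (E1 1) (E1 3) (E1 5) (E1 7) (E2 0) (E2 2) (E2 4) (E2 6)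
  simpa [Fin.sum_univ_eight, w8] using h

lemma cos_three_pi_div_four : Real.cos (3 * Real.pi / 4) = -(√2 / 2) := by
  rw [show 3 * Real.pi / 4 = Real.pi - Real.pi / 4 by ring, Real.cos_pi_sub, Real.cos_pi_div_four]

lemma cos_five_pi_div_four : Real.cos (5 * Real.pi / 4) = -(√2 / 2) := by
  rw [show 5 * Real.pi / 4 = Real.pi / 4 + Real.pi by ring, Real.cos_add_pi,
    Real.cos_pi_div_four]

lemma cos_seven_pi_div_four : Real.cos (7 * Real.pi / 4) = √2 / 2 := by
  rw [show 7 * Real.pi / 4 = 2 * Real.pi - Real.pi / 4 by ring, Real.cos_two_pi_sub,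
    Real.cos_pi_div_four]

lemma quantum_payoff_eq :
    ∑ x : Fin 8, ∑ y : Fin 8, (w8 x y : ℝ) *
        ((1 / 4) * (1 + Real.cos (2 * Real.pi * (((x : ℕ) : ℝ) - ((y : ℕ) : ℝ)) / 8)))
      = 12 * √2 - 8 := by
  have h₁ : Real.cos (2 * Real.pi * 1 / 8) = √2 / 2 := by
    rw [← Real.cos_pi_div_four]; ring_nf
  have h₃ : Real.cos (2 * Real.pi * 3 / 8) = -(√2 / 2) := by
    rw [← cos_three_pi_div_four]; ring_nf
  have h₅ : Real.cos (2 * Real.pi * 5 / 8) = -(√2 / 2) := by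
    rw [← cos_five_pi_div_four]; ring_nf
  have h₇ : Real.cos (2 * Real.pi * 7 / 8) = √2 / 2 := by
    rw [← cos_seven_pi_div_four]; ring_nf
  have hneg (t : ℝ) : Real.cos (2 * Real.pi * (-t) / 8) = Real.cos (2 * Real.pi * t / 8) := by
    rw [← Real.cos_neg]; ring_nf
  have e (x y : Fin 8) (t : ℝ) (h : ((x : ℕ) : ℝ) - ((y : ℕ) : ℝ) = t) :
      Real.cos (2 * Real.pi * (((x : ℕ) : ℝ) - ((y : ℕ) : ℝ)) / 8) =
        Real.cos (2 * Real.pi * t / 8) := by rw [h]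
  simp only [Fin.sum_univ_eight, w8]
  rw [e 1 0 1, e 1 2 (-1), e 1 4 (-3), e 1 6 (-5), e 3 0 3, e 3 2 1, e 3 4 (-1), e 3 6 (-3),
    e 5 0 5, e 5 2 3, e 5 4 1, e 5 6 (-1), e 7 0 7, e 7 2 5, e 7 4 3, e 7 6 1]
  · simp only [hneg, h₁, h₃, h₅, h₇]
    simp
    ring
  all_goals norm_num

theorem octagon_witness :
    (∀ (E1 E2 : Fin 8 → Bool) (D : Bool × Bool → Bool),
      (∑ p ∈ Finset.univ.filter
          (fun p : Fin 8 × Fin 8 => D (E1 p.1, E2 p.2) = false), w8 p.1 p.2) ≤ 8) ∧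
    (∑ x : Fin 8, ∑ y : Fin 8, (w8 x y : ℝ) *
        ((1 / 4) * (1 + Real.cos (2 * Real.pi * (((x : ℕ) : ℝ) - ((y : ℕ) : ℝ)) / 8)))
      = 12 * Real.sqrt 2 - 8) ∧
    12 * Real.sqrt 2 - 8 > 8 := by
  refine ⟨classical_payoff_le, quantum_payoff_eq, ?_⟩
  have h : (4 / 3 : ℝ) < √2 := Real.lt_sqrt_of_sq_lt (by norm_num)
  linarith
end
end

section
/- Let w₉(x,y) = c_{(y−x) mod 9} for x,y ∈ {0,…,8}, where (c₀,…,c₈) = (0,0,1,−1,−1,−1,−1,1,0). Then: (i) for all deterministic strategies E1,E2 : {0,…,8} → {0,1} and D : {0,1}×{0,1} → {0,1}, the payoff Σ_{(x,y) : D(E1(x),E2(y))=0} w₉(x,y) ≤ 2; (ii) Σ_{x,y} w₉(x,y)·(1/4)(1 + cos(2π(x−y)/9)) = (√3/2)(cos(π/18) − sin(π/9)) + 3(cos(π/9) + sin(π/18)) + √3·sin(2π/9) − 9/4; and (iii) this value exceeds 2. -/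
noncomputable section

/-- Witness coefficients for the nonagon MAC. -/
def c9 : Fin 9 → ℤ := ![0, 0, 1, -1, -1, -1, -1, 1, 0]

/-- The witness `w₉(x,y) = c_{(y−x) mod 9}`. -/
def w9 (x y : Fin 9) : ℤ := c9 (y - x)

/-- The quantum value of the nonagon witness. -/
def q9 : ℝ :=
  (Real.sqrt 3 / 2) * (Real.cos (Real.pi / 18) - Real.sin (Real.pi / 9))
    + 3 * (Real.cos (Real.pi / 9) + Real.sin (Real.pi / 18))
    + Real.sqrt 3 * Real.sin (2 * Real.pi / 9) - 9 / 4

/-- The payoff collected in column `y` when output `0` is returned exactly on the rows in `E`. -/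
def witnessColumn (E : Fin 9 → Bool) (y : Fin 9) : ℤ :=
  ∑ x, bif E x then w9 x y else 0

/-- The nonzero entries of column `y` lie in the rows `y + 2, …, y + 7`. -/
theorem witnessColumn_eq (E : Fin 9 → Bool) (y : Fin 9) :
    witnessColumn E y = (E (y + 2)).toInt + (E (y + 7)).toInt
      - ((E (y + 3)).toInt + (E (y + 4)).toInt + (E (y + 5)).toInt + (E (y + 6)).toInt) := by
  have key : ∀ x : Fin 9, (bif E (y + x) then w9 (y + x) y else 0) =
      (E (y + x)).toInt * c9 (-x) := by
    intro x
    have hx : y - (y + x) = -x := by abel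
    cases h : E (y + x) <;> simp [w9, hx]
  rw [witnessColumn, ← Equiv.sum_comp (Equiv.addLeft y)]
  simp only [Equiv.coe_addLeft, key]
  have h0 : c9 (-0) = 0 := by decide
  have h1 : c9 (-1) = 0 := by decide
  have h2 : c9 (-2) = 1 := by decide
  have h3 : c9 (-3) = -1 := by decide
  have h4 : c9 (-4) = -1 := by decide
  have h5 : c9 (-5) = -1 := by decide
  have h6 : c9 (-6) = -1 := by decide
  have h7 : c9 (-7) = 1 := by decide
  have h8 : c9 (-8) = 0 := by decide
  simp only [Fin.sum_univ_succ, Fin.sum_univ_zero]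
  change _ * c9 (-0) + (_ * c9 (-1) + (_ * c9 (-2) + (_ * c9 (-3) + (_ * c9 (-4) +
    (_ * c9 (-5) + (_ * c9 (-6) + (_ * c9 (-7) + (_ * c9 (-8) + 0)))))))) = _
  rw [h0, h1, h2, h3, h4, h5, h6, h7, h8]
  change _ * 0 + ((E (y + 1)).toInt * 0 + ((E (y + 2)).toInt * 1 + ((E (y + 3)).toInt * (-1) +
    ((E (y + 4)).toInt * (-1) + ((E (y + 5)).toInt * (-1) + ((E (y + 6)).toInt * (-1) +
    ((E (y + 7)).toInt * 1 + (_ * 0 + 0)))))))) = _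
  ring

theorem witnessColumn_not (E : Fin 9 → Bool) (y : Fin 9) :
    witnessColumn (fun x => !E x) y = -2 - witnessColumn E y := by
  have h : ∀ b : Bool, (!b).toInt = 1 - b.toInt := by decide
  simp only [witnessColumn_eq, h]
  ring

theorem column_maxima_le (a b c d e f g h i : Bool) :
    let E : Fin 9 → ℤ := ![a.toInt, b.toInt, c.toInt, d.toInt, e.toInt, f.toInt, g.toInt,
      h.toInt, i.toInt]
    let G : Fin 9 → ℤ := fun y => E (y + 2) + E (y + 7)
      - (E (y + 3) + E (y + 4) + E (y + 5) + E (y + 6))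
    ∑ y, max 0 (G y) ≤ 2 ∧ ∑ y, max (G y) (-2 - G y) ≤ 2 := by
  revert a b c d e f g h i
  decide +kernel

theorem witnessColumn_maxima_le (E : Fin 9 → Bool) :
    ∑ y, max 0 (witnessColumn E y) ≤ 2 ∧
      ∑ y, max (witnessColumn E y) (-2 - witnessColumn E y) ≤ 2 := by
  have h := column_maxima_le (E 0) (E 1) (E 2) (E 3) (E 4) (E 5) (E 6) (E 7) (E 8)
  have hE : ![(E 0).toInt, (E 1).toInt, (E 2).toInt, (E 3).toInt, (E 4).toInt, (E 5).toInt,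
      (E 6).toInt, (E 7).toInt, (E 8).toInt] = fun x => (E x).toInt := by
    funext x
    fin_cases x <;> rfl
  rw [hE] at h
  simpa only [witnessColumn_eq] using h

/-- Every deterministic strategy has payoff at most `2`. -/
theorem payoff_le_two (E1 E2 : Fin 9 → Bool) (D : Bool × Bool → Bool) :
    (∑ p ∈ Finset.univ.filter
      (fun p : Fin 9 × Fin 9 => D (E1 p.1, E2 p.2) = false), w9 p.1 p.2) ≤ 2 := by
  have hcol : (∑ p ∈ Finset.univ.filter
      (fun p : Fin 9 × Fin 9 => D (E1 p.1, E2 p.2) = false), w9 p.1 p.2) =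
      ∑ y, ((bif D (true, E2 y) then 0 else witnessColumn E1 y) +
        (bif D (false, E2 y) then 0 else -2 - witnessColumn E1 y)) := by
    rw [Finset.sum_filter, Fintype.sum_prod_type_right]
    refine Finset.sum_congr rfl fun y _ => ?_
    rw [← witnessColumn_not]
    have h (p : Bool) (f : Fin 9 → ℤ) : (bif p then 0 else ∑ x, f x) =
        ∑ x, bif p then 0 else f x := by cases p <;> simp
    rw [witnessColumn, witnessColumn, h, h, ← Finset.sum_add_distrib]
    refine Finset.sum_congr rfl fun x _ => ?_
    cases hx : E1 x <;> cases D (true, E2 y) <;> cases D (false, E2 y) <;> simp_all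
  rw [hcol]
  obtain ⟨h0, hx⟩ := witnessColumn_maxima_le E1
  obtain ⟨h1, -⟩ := witnessColumn_maxima_le fun x => !E1 x
  simp only [witnessColumn_not] at h1
  have bound {M : Fin 9 → ℤ} (hM : ∑ y, M y ≤ 2)
      (h : ∀ b y, (bif D (true, b) then 0 else witnessColumn E1 y) +
        (bif D (false, b) then 0 else -2 - witnessColumn E1 y) ≤ M y) :
      ∑ y, ((bif D (true, E2 y) then 0 else witnessColumn E1 y) +
        (bif D (false, E2 y) then 0 else -2 - witnessColumn E1 y)) ≤ 2 :=
    (Finset.sum_le_sum fun y _ => h (E2 y) y).trans hM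
  cases htt : D (true, true) <;> cases htf : D (true, false) <;>
    cases hft : D (false, true) <;> cases hff : D (false, false) <;>
    first
    | refine bound h0 fun b y => ?_; cases b <;> simp only [htt, htf, hft, hff, cond] <;> omega
    | refine bound h1 fun b y => ?_; cases b <;> simp only [htt, htf, hft, hff, cond] <;> omega
    | refine bound hx fun b y => ?_; cases b <;> simp only [htt, htf, hft, hff, cond] <;> omega

open Real in
theorem q9_eq : q9 = 9 / 2 * (√3 * sin (2 * π / 9)) - 9 / 4 := by
  have h1 : cos (π / 18) - sin (π / 9) = sin (2 * π / 9) := by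
    rw [← cos_pi_div_two_sub, cos_sub_cos, show (π / 18 + (π / 2 - π / 9)) / 2 = 2 * π / 9 by ring,
      show (π / 18 - (π / 2 - π / 9)) / 2 = -(π / 6) by ring, sin_neg, sin_pi_div_six]
    ring
  have h2 : cos (π / 9) + sin (π / 18) = √3 * sin (2 * π / 9) := by
    rw [← cos_pi_div_two_sub, ← cos_pi_div_two_sub, cos_add_cos,
      show (π / 9 + (π / 2 - π / 18)) / 2 = π / 2 - 2 * π / 9 by ring,
      show (π / 9 - (π / 2 - π / 18)) / 2 = -(π / 6) by ring, cos_neg, cos_pi_div_six]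
    ring
  rw [q9, h1, h2]
  ring

open Real in
theorem two_lt_q9 : 2 < q9 := by
  have hlo := pi_gt_d2
  have hhi := pi_lt_d2
  have hs : 0.6 < sin (2 * π / 9) := by
    have h := sin_gt_sub_cube (x := 2 * π / 9) (by positivity)
    have hc : (2 * π / 9) ^ 3 ≤ 0.35 :=
      (pow_le_pow_left₀ (by positivity) (show 2 * π / 9 ≤ 0.7 by linarith) 3).trans (by norm_num)
    linarith
  have h3 : 1.7 < √3 := lt_sqrt_of_sq_lt (by norm_num)
  rw [q9_eq]
  nlinarith

open Real in
theorem quantum_value_eq_q9 :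
    (∑ x : Fin 9, ∑ y : Fin 9, (w9 x y : ℝ) *
      ((1 / 4) * (1 + cos (2 * π * (((x : ℕ) : ℝ) - ((y : ℕ) : ℝ)) / 9)))) = q9 := by
  have hsub (x z : Fin 9) :
      cos (2 * π * (((x : ℕ) : ℝ) - ((z + x : Fin 9) : ℕ)) / 9) = cos (2 * π * (z : ℕ) / 9) := by
    have hdiv := Nat.div_add_mod ((z : ℕ) + x) 9
    have hcast : (((z + x : Fin 9) : ℕ) : ℝ) = z + x - 9 * (((z : ℕ) + x) / 9 : ℕ) := by
      rw [Fin.val_add, eq_sub_iff_add_eq']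
      exact_mod_cast hdiv
    rw [hcast, ← cos_neg, ← cos_sub_nat_mul_two_pi (2 * π * (z : ℕ) / 9) (((z : ℕ) + x) / 9)]
    congr 1
    ring
  have hrow (x : Fin 9) : ∑ y : Fin 9, (w9 x y : ℝ) *
      ((1 / 4) * (1 + cos (2 * π * (((x : ℕ) : ℝ) - ((y : ℕ) : ℝ)) / 9))) =
      ∑ z : Fin 9, (c9 z : ℝ) * ((1 / 4) * (1 + cos (2 * π * (z : ℕ) / 9))) := by
    rw [← Equiv.sum_comp (Equiv.addRight x)]
    refine Finset.sum_congr rfl fun z _ => ?_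
    rw [Equiv.coe_addRight, hsub, w9, add_sub_cancel_right]
  have hsymm (k : ℝ) : cos (2 * π * (9 - k) / 9) = cos (2 * π * k / 9) := by
    rw [← cos_two_pi_sub]
    congr 1
    ring
  have h3 : cos (2 * π * 3 / 9) = -1 / 2 := by
    rw [show 2 * π * 3 / 9 = π - π / 3 by ring, cos_pi_sub, cos_pi_div_three]
    ring
  have h7 := hsymm 2
  have h6 := hsymm 3
  have h5 := hsymm 4
  have h24 : cos (2 * π * 2 / 9) - cos (2 * π * 4 / 9) = √3 * sin (2 * π / 9) := by
    rw [cos_sub_cos, show (2 * π * 2 / 9 + 2 * π * 4 / 9) / 2 = π - π / 3 by ring,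
      show (2 * π * 2 / 9 - 2 * π * 4 / 9) / 2 = -(2 * π / 9) by ring, sin_neg, sin_pi_sub,
      sin_pi_div_three]
    ring
  norm_num at h7 h6 h5
  simp only [hrow, Finset.sum_const, Finset.card_univ, Fintype.card_fin, nsmul_eq_mul]
  rw [q9_eq, ← h24]
  simp [Fin.sum_univ_succ, c9]
  norm_num [h7, h6, h5, h3]
  ring

theorem nonagon_witness :
    (∀ (E1 E2 : Fin 9 → Bool) (D : Bool × Bool → Bool),
      (∑ p ∈ Finset.univ.filter
          (fun p : Fin 9 × Fin 9 => D (E1 p.1, E2 p.2) = false), w9 p.1 p.2) ≤ 2) ∧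
    (∑ x : Fin 9, ∑ y : Fin 9, (w9 x y : ℝ) *
        ((1 / 4) * (1 + Real.cos (2 * Real.pi * (((x : ℕ) : ℝ) - ((y : ℕ) : ℝ)) / 9)))
      = q9) ∧
    q9 > 2 := by
  exact ⟨payoff_le_two, quantum_value_eq_q9, two_lt_q9⟩
end
end
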